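/- Under the (f,Γ)-GAN assumptions (see context), the following error decomposition holds ℙ-almost surely: D_f^Γ(Q‖P_{θ*_{n,m}}) − inf_{θ∈Θ} D_f^Γ(Q‖P_θ) ≤ sup_{h∈Γ̃,θ∈Θ}{ Λ_f^{P_{Z,m}}[h∘Φ_θ] − Λ_f^{P_Z}[h∘Φ_θ] } + sup_{h∈Γ̃,θ∈Θ}{ Λ_f^{P_Z}[h∘Φ_θ] − Λ_f^{P_{Z,m}}[h∘Φ_θ] } + sup_{h∈Γ̃}{ E_Q[h] − E_{Q_n}[h] } + sup_{h∈Γ̃}{ E_{Q_n}[h] − E_Q[h] } + (1 + (f*)'_+(z₀+β−α)) sup_{h∈Γ} inf_{h̃∈Γ̃} ‖h−h̃‖_∞ + ε^{opt}_{n,m}. -/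

import Mathlib

open MeasureTheory Set Filter Topology
open scoped ENNReal NNReal Classical

noncomputable section

/-- The interval `(a, b)` with `b` possibly infinite. -/
def Dom (a : ℝ) (b : EReal) : Set ℝ := {t : ℝ | a < t ∧ (t : EReal) < b}

/-- Legendre transform of `f` on `(a,b)`, with values in `(-∞, ∞]` (modeled by `EReal`). -/
def fStar (f : ℝ → ℝ) (a : ℝ) (b : EReal) (z : ℝ) : EReal :=
  ⨆ t ∈ Dom a b, ((z * t - f t : ℝ) : EReal)

/-- Real-valued version of the Legendre transform (junk value where it is `⊤`). -/
def fStarR (f : ℝ → ℝ) (a : ℝ) (b : EReal) (z : ℝ) : ℝ := (fStar f a b z).toReal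

/-- Right derivative of `g` at `z`. -/
def rderiv (g : ℝ → ℝ) (z : ℝ) : ℝ := derivWithin g (Ici z) z

/-- `z₀ := f'_+(1)`. -/
def zz (f : ℝ → ℝ) : ℝ := rderiv f 1

/-- Integral of an `EReal`-valued function: the Bochner integral if the function is
a.e. finite and integrable, and `⊤` otherwise. -/
def eIntegral {X : Type*} [MeasurableSpace X] (P : Measure X) (g : X → EReal) : EReal :=
  if (∀ᵐ x ∂P, g x ≠ ⊤) ∧ Integrable (fun x => (g x).toReal) P
  then ((∫ x, (g x).toReal ∂P : ℝ) : EReal) else ⊤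

/-- The generalized cumulant generating function `Λ_f^P[h]`. -/
def cgf {X : Type*} [MeasurableSpace X] (f : ℝ → ℝ) (a : ℝ) (b : EReal)
    (P : Measure X) (h : X → ℝ) : EReal :=
  ⨅ ν : ℝ, ((ν : EReal) + eIntegral P (fun x => fStar f a b (h x - ν)))

/-- Real-valued `Λ_f^P[h]`. -/
def cgfR {X : Type*} [MeasurableSpace X] (f : ℝ → ℝ) (a : ℝ) (b : EReal)
    (P : Measure X) (h : X → ℝ) : ℝ := (cgf f a b P h).toReal

/-- `Λ_f : ℝⁿ → ℝ` (with values in `EReal`). -/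
def lamVec (f : ℝ → ℝ) (a : ℝ) (b : EReal) {n : ℕ} (x : Fin n → ℝ) : EReal :=
  ⨅ ν : ℝ, ((ν : EReal) + ((n : ℝ)⁻¹ : EReal) * ∑ i, fStar f a b (x i - ν))

/-- Empirical measure of `n` points. -/
def empMeas {X : Type*} [MeasurableSpace X] (n : ℕ) (xs : Fin n → X) : Measure X :=
  (n : ℝ≥0∞)⁻¹ • ∑ i, Measure.dirac (xs i)

/-- The `(f,Γ)`-divergence `D_f^Γ(Q‖P)`. -/
def Dfg {X : Type*} [MeasurableSpace X] (f : ℝ → ℝ) (a : ℝ) (b : EReal)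
    (Γ : Set (X → ℝ)) (Q P : Measure X) : ℝ :=
  sSup {r : ℝ | ∃ h ∈ Γ, r = ∫ x, h x ∂Q - cgfR f a b P h}

/-- Empirical Rademacher complexity of `Ψ` at the sample `y`. -/
def empRad {Y : Type*} (Ψ : Set (Y → ℝ)) (n : ℕ) (y : Fin n → Y) : ℝ :=
  (2 ^ n : ℝ)⁻¹ * ∑ σ : Fin n → Bool,
    sSup {r : ℝ | ∃ ψ ∈ Ψ, r = (n : ℝ)⁻¹ * ∑ i, (if σ i then 1 else -1) * ψ (y i)}

/-- Rademacher complexity of `Ψ` relative to `P` with `n` samples. -/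
def rad {Y : Type*} [MeasurableSpace Y] (Ψ : Set (Y → ℝ)) (P : Measure Y) (n : ℕ) : ℝ :=
  ∫ y, empRad Ψ n y ∂(Measure.pi fun _ : Fin n => P)

/-- `Δ_{f,n}`. -/
def Δq (f : ℝ → ℝ) (a : ℝ) (b : EReal) (α β : ℝ) (n : ℕ) : ℝ :=
  sInf ((fun z => (n : ℝ) * (-z + (((n : ℝ) - 1) / (n : ℝ)) * fStarR f a b z
      + (1 / (n : ℝ)) * fStarR f a b (β - α + z))) '' Icc (zz f - (β - α)) (zz f))

/-- `sup_{h ∈ Γ} inf_{h̃ ∈ Γ̃} ‖h − h̃‖_∞`. -/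
def approxErr {X : Type*} (Γ Γt : Set (X → ℝ)) : ℝ :=
  sSup {r : ℝ | ∃ h ∈ Γ, r = sInf {s : ℝ | ∃ ht ∈ Γt, s = ⨆ x, |h x - ht x|}}

/-- A countable subset which is pointwise-limit dense. -/
def PtwiseDenseCount {X : Type*} (Γ : Set (X → ℝ)) : Prop :=
  ∃ Γ₀ ⊆ Γ, Γ₀.Countable ∧ ∀ h ∈ Γ, ∃ s : ℕ → X → ℝ,
    (∀ j, s j ∈ Γ₀) ∧ ∀ x, Tendsto (fun j => s j x) atTop (𝓝 (h x))

/-- The quantity `K_{f,Ψ,P,n}` from Definition 3.4: either `(f*)'_+` is Lipschitz on the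
relevant interval and `Ψ` contains a constant, in which case `K` is the minimum of the two
expressions, or `K` is the second expression. -/
def Kchoice (f : ℝ → ℝ) (a : ℝ) (b : EReal) (α β : ℝ) {Y : Type*} [MeasurableSpace Y]
    (Ψ : Set (Y → ℝ)) (P : Measure Y) (n : ℕ) (K : ℝ) : Prop :=
  (∃ L : ℝ≥0, LipschitzOnWith L (rderiv (fStarR f a b))
      (Icc (zz f - (β - α)) (zz f + (β - α))) ∧
    (∃ c : ℝ, (fun _ => c) ∈ Ψ) ∧
    K = min ((1 + 2 * (β - α) * (L : ℝ)) * rad Ψ P n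
        + (β - α) ^ 2 * (L : ℝ) / (2 * Real.sqrt n))
      (rderiv (fStarR f a b) (β - α + zz f) * (rad Ψ P n + (β - α) / (2 * Real.sqrt n))))
  ∨ K = rderiv (fStarR f a b) (β - α + zz f) * (rad Ψ P n + (β - α) / (2 * Real.sqrt n))

/-- Covering number of a (pseudo)metric space by `ε`-balls. -/
def coverNum (Θ : Type*) [PseudoMetricSpace Θ] (ε : ℝ) : ℝ≥0∞ :=
  ⨅ s ∈ {s : Finset Θ | ∀ θ : Θ, ∃ c ∈ s, dist θ c ≤ ε}, ((s.card : ℝ≥0∞))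

end

section LegendreTransform

variable {f : ℝ → ℝ} {a : ℝ} {b : EReal}

lemma le_fStar {t : ℝ} (ht : t ∈ Dom a b) (z : ℝ) : ((z * t - f t : ℝ) : EReal) ≤ fStar f a b z :=
  le_iSup₂ (f := fun t (_ : t ∈ Dom a b) => ((z * t - f t : ℝ) : EReal)) t ht

lemma self_le_fStar (h1 : (1 : ℝ) ∈ Dom a b) (hf1 : f 1 = 0) (z : ℝ) :
    (z : EReal) ≤ fStar f a b z := by
  simpa [hf1] using le_fStar (f := f) h1 z

lemma fStar_ne_bot (h1 : (1 : ℝ) ∈ Dom a b) (hf1 : f 1 = 0) (z : ℝ) : fStar f a b z ≠ ⊥ :=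
  ne_bot_of_le_ne_bot (EReal.coe_ne_bot z) (self_le_fStar h1 hf1 z)

lemma fStar_mono (ha0 : 0 ≤ a) : Monotone (fStar f a b) := by
  intro x y hxy
  refine iSup₂_le fun t ht => le_trans ?_ (le_fStar ht y)
  exact_mod_cast sub_le_sub_right (mul_le_mul_of_nonneg_right hxy (ha0.trans ht.1.le)) _

lemma measurable_fStar (ha0 : 0 ≤ a) : Measurable (fStar f a b) := (fStar_mono ha0).measurable

lemma self_le_toReal_fStar (h1 : (1 : ℝ) ∈ Dom a b) (hf1 : f 1 = 0) {z : ℝ}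
    (hz : fStar f a b z ≠ ⊤) : z ≤ (fStar f a b z).toReal := by
  simpa using EReal.toReal_le_toReal (self_le_fStar h1 hf1 z) (EReal.coe_ne_bot z) hz

lemma fStar_zz (hconv : ConvexOn ℝ (Dom a b) f) (h1 : (1 : ℝ) ∈ interior (Dom a b))
    (hf1 : f 1 = 0) : fStar f a b (zz f) = zz f := by
  have h1' := interior_subset h1
  refine le_antisymm (iSup₂_le fun t ht => ?_) (self_le_fStar h1' hf1 _)
  have hright : zz f = derivWithin f (Ioi 1) 1 := (derivWithin_Ioi_eq_Ici f 1).symm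
  have key : zz f * (t - 1) ≤ f t := by
    rcases lt_trichotomy t 1 with hlt | rfl | hgt
    · have h := (hconv.slope_le_leftDeriv_of_mem_interior ht h1 hlt).trans
        (hconv.leftDeriv_le_rightDeriv_of_mem_interior h1)
      rw [← hright, slope_def_field, hf1, div_le_iff₀ (by linarith)] at h
      linarith
    · simp [hf1]
    · have h := hconv.rightDeriv_le_slope_of_mem_interior h1 ht hgt
      rw [← hright, slope_def_field, hf1, le_div_iff₀ (by linarith)] at h
      linarith
  exact_mod_cast (by linarith : zz f * t - f t ≤ zz f)

lemma convexOn_fStarR (h1 : (1 : ℝ) ∈ Dom a b) (hf1 : f 1 = 0) {S : Set ℝ} (hS : Convex ℝ S)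
    (hfin : ∀ z ∈ S, fStar f a b z ≠ ⊤) : ConvexOn ℝ S (fStarR f a b) := by
  have hcoe : ∀ z ∈ S, (fStarR f a b z : EReal) = fStar f a b z := fun z hz =>
    EReal.coe_toReal (hfin z hz) (fStar_ne_bot h1 hf1 z)
  refine ⟨hS, fun x hx y hy s t hs ht hst => ?_⟩
  have hmem := hS hx hy hs ht hst
  rw [← EReal.coe_le_coe_iff, hcoe _ hmem]
  refine iSup₂_le fun u hu => ?_
  have hxu := le_fStar (f := f) hu x
  have hyu := le_fStar (f := f) hu y
  rw [← hcoe x hx, EReal.coe_le_coe_iff] at hxu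
  rw [← hcoe y hy, EReal.coe_le_coe_iff] at hyu
  rw [EReal.coe_le_coe_iff]
  simp only [smul_eq_mul]
  calc (s * x + t * y) * u - f u = s * (x * u - f u) + t * (y * u - f u) := by
        linear_combination f u * hst
    _ ≤ _ := by gcongr

/-- The right derivative of `f*` is at least `1` to the right of `z₀`. -/
lemma one_le_rderiv_fStarR (ha0 : 0 ≤ a) (hconv : ConvexOn ℝ (Dom a b) f)
    (h1 : (1 : ℝ) ∈ interior (Dom a b)) (hf1 : f 1 = 0) {w : ℝ} (hw : zz f ≤ w)
    (hwi : w ∈ interior {z : ℝ | fStar f a b z < ⊤}) : 1 ≤ rderiv (fStarR f a b) w := by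
  have h1' := interior_subset h1
  obtain ⟨ε, hε, hball⟩ := Metric.isOpen_iff.1 isOpen_interior w hwi
  have hfin : ∀ z ∈ Iio (w + ε), fStar f a b z ≠ ⊤ := by
    intro z hz
    obtain ⟨y, hy, hy'⟩ := exists_between
      (max_lt (show z < w + ε from hz) (by linarith : w < w + ε))
    have hyb : y ∈ Metric.ball w ε := by
      rw [Metric.mem_ball, Real.dist_eq, abs_lt]
      constructor <;> linarith [le_max_right z w]
    have hyfin : y ∈ {z : ℝ | fStar f a b z < ⊤} := interior_subset (hball hyb)
    exact ((fStar_mono ha0 ((le_max_left z w).trans hy.le)).trans_lt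
      (show fStar f a b y < ⊤ from hyfin)).ne
  have hcv := convexOn_fStarR h1' hf1 (convex_Iio (w + ε)) hfin
  have hint : interior (Iio (w + ε)) = Iio (w + ε) := isOpen_Iio.interior_eq
  have hz₀ : zz f ∈ interior (Iio (w + ε)) := by rw [hint]; exact lt_of_le_of_lt hw (by linarith)
  have hw' : w ∈ interior (Iio (w + ε)) := by rw [hint]; exact (by linarith : w < w + ε)
  have hmono := hcv.monotoneOn_rightDeriv hz₀ hw' hw
  rw [rderiv, ← derivWithin_Ioi_eq_Ici]
  refine le_trans ?_ hmono
  simp only [hcv.rightDeriv_eq_sInf_slope_of_mem_interior hz₀]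
  refine le_csInf ?_ ?_
  · exact ⟨_, w + ε / 2, ⟨by simp [hε], by linarith⟩, rfl⟩
  · rintro _ ⟨y, ⟨hy, hzy⟩, rfl⟩
    rw [slope_def_field, le_div_iff₀ (by linarith)]
    have hzz : fStarR f a b (zz f) = zz f := by simp [fStarR, fStar_zz hconv h1 hf1]
    have hyy : y ≤ fStarR f a b y := self_le_toReal_fStar h1' hf1 (hfin y hy)
    linarith

end LegendreTransform

section CumulantGeneratingFunction

variable {f : ℝ → ℝ} {a : ℝ} {b : EReal} {Y : Type*} [MeasurableSpace Y] {P : Measure Y}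

lemma eIntegral_map {Y' : Type*} [MeasurableSpace Y'] {φ : Y → Y'} (hφ : Measurable φ)
    {g : Y' → EReal} (hg : Measurable g) :
    eIntegral (P.map φ) g = eIntegral P (g ∘ φ) := by
  have hgr : AEStronglyMeasurable (fun x => (g x).toReal) (P.map φ) :=
    hg.ereal_toReal.aestronglyMeasurable
  have hset : MeasurableSet {x | g x ≠ ⊤} := (hg (measurableSet_singleton ⊤)).compl
  simp only [eIntegral, ae_map_iff hφ.aemeasurable hset, integrable_map_measure hgr hφ.aemeasurable,
    integral_map hφ.aemeasurable hgr, Function.comp_def]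

lemma cgf_map (ha0 : 0 ≤ a) {Y' : Type*} [MeasurableSpace Y'] {φ : Y → Y'} (hφ : Measurable φ)
    {h : Y' → ℝ} (hh : Measurable h) :
    cgf f a b (P.map φ) h = cgf f a b P (fun y => h (φ y)) := by
  refine iInf_congr fun ν => ?_
  exact congrArg _ (eIntegral_map hφ ((measurable_fStar ha0).comp (hh.sub_const ν)))

lemma eIntegral_fStar_mono (ha0 : 0 ≤ a) (h1 : (1 : ℝ) ∈ Dom a b) (hf1 : f 1 = 0)
    {g g' : Y → ℝ} (hgm : Measurable g) (hgi : Integrable g P) (hgg : ∀ y, g y ≤ g' y) :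
    eIntegral P (fun y => fStar f a b (g y)) ≤ eIntegral P (fun y => fStar f a b (g' y)) := by
  by_cases hfin : (∀ᵐ y ∂P, fStar f a b (g' y) ≠ ⊤) ∧
      Integrable (fun y => (fStar f a b (g' y)).toReal) P
  · have hle : ∀ y, fStar f a b (g y) ≤ fStar f a b (g' y) := fun y => fStar_mono ha0 (hgg y)
    have htop : ∀ᵐ y ∂P, fStar f a b (g y) ≠ ⊤ :=
      hfin.1.mono fun y hy => ne_top_of_le_ne_top hy (hle y)
    have hreal : ∀ᵐ y ∂P, (fStar f a b (g y)).toReal ≤ (fStar f a b (g' y)).toReal :=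
      hfin.1.mono fun y hy => EReal.toReal_le_toReal (hle y) (fStar_ne_bot h1 hf1 _) hy
    have hint : Integrable (fun y => (fStar f a b (g y)).toReal) P :=
      integrable_of_le_of_le ((measurable_fStar ha0).comp hgm).ereal_toReal.aestronglyMeasurable
        (htop.mono fun y hy => self_le_toReal_fStar h1 hf1 hy) hreal hgi hfin.2
    rw [eIntegral, eIntegral, if_pos ⟨htop, hint⟩, if_pos hfin, EReal.coe_le_coe_iff]
    exact integral_mono_ae hint hfin.2 hreal
  · rw [eIntegral.eq_def P (fun y => fStar f a b (g' y)), if_neg hfin]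
    exact le_top

lemma integral_le_eIntegral_fStar (h1 : (1 : ℝ) ∈ Dom a b) (hf1 : f 1 = 0)
    {g : Y → ℝ} (hgi : Integrable g P) :
    ((∫ y, g y ∂P : ℝ) : EReal) ≤ eIntegral P (fun y => fStar f a b (g y)) := by
  rw [eIntegral]
  split_ifs with hfin
  · rw [EReal.coe_le_coe_iff]
    exact integral_mono_ae hgi hfin.2 (hfin.1.mono fun y hy => self_le_toReal_fStar h1 hf1 hy)
  · exact le_top

lemma integral_le_cgf [IsProbabilityMeasure P] (h1 : (1 : ℝ) ∈ Dom a b) (hf1 : f 1 = 0)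
    {h : Y → ℝ} (hi : Integrable h P) : ((∫ y, h y ∂P : ℝ) : EReal) ≤ cgf f a b P h := by
  refine le_iInf fun ν => ?_
  have hν := integral_le_eIntegral_fStar h1 hf1 (hi.sub (integrable_const ν))
  simp only [Pi.sub_apply, integral_sub hi (integrable_const ν), integral_const, probReal_univ,
    one_smul] at hν
  calc ((∫ y, h y ∂P : ℝ) : EReal) = (ν : EReal) + ((∫ y, h y ∂P - ν : ℝ) : EReal) := by
        rw [← EReal.coe_add, add_sub_cancel]
    _ ≤ _ := by gcongr

/-- `Λ_f^P` is monotone and commutes with adding constants. -/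
lemma cgf_le_add (ha0 : 0 ≤ a) (h1 : (1 : ℝ) ∈ Dom a b) (hf1 : f 1 = 0) [IsFiniteMeasure P]
    {h h' : Y → ℝ} (hm : Measurable h) (hi : Integrable h P) {c : ℝ}
    (hle : ∀ y, h y ≤ h' y + c) : cgf f a b P h ≤ cgf f a b P h' + c := by
  rw [← EReal.sub_le_iff_le_add (.inl (EReal.coe_ne_bot c)) (.inl (EReal.coe_ne_top c))]
  refine le_iInf fun ν => ?_
  refine EReal.sub_le_of_le_add ((iInf_le _ (ν + c)).trans ?_)
  rw [EReal.coe_add, add_right_comm]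
  gcongr
  exact eIntegral_fStar_mono ha0 h1 hf1 (hm.sub_const _) (hi.sub (integrable_const _))
    fun y => by linarith [hle y]

lemma cgf_const_le [IsProbabilityMeasure P] (hconv : ConvexOn ℝ (Dom a b) f)
    (h1 : (1 : ℝ) ∈ interior (Dom a b)) (hf1 : f 1 = 0) (c : ℝ) :
    cgf f a b P (fun _ => c) ≤ c := by
  refine (iInf_le _ (c - zz f)).trans ?_
  have hint : eIntegral P (fun _ : Y => fStar f a b (c - (c - zz f))) = zz f := by
    simp [fStar_zz hconv h1 hf1, eIntegral]
  rw [hint, ← EReal.coe_add, sub_add_cancel]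

lemma integrable_of_forall_mem_Icc [IsFiniteMeasure P] {h : Y → ℝ} {α β : ℝ} (hm : Measurable h)
    (hb : ∀ y, h y ∈ Icc α β) : Integrable h P :=
  Integrable.of_mem_Icc α β hm.aemeasurable (ae_of_all _ hb)

lemma integral_mem_Icc [IsProbabilityMeasure P] {h : Y → ℝ} {α β : ℝ} (hm : Measurable h)
    (hb : ∀ y, h y ∈ Icc α β) : ∫ y, h y ∂P ∈ Icc α β := by
  have hi : Integrable h P := integrable_of_forall_mem_Icc hm hb
  constructor
  · simpa using integral_mono (integrable_const α) hi fun y => (hb y).1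
  · simpa using integral_mono hi (integrable_const β) fun y => (hb y).2

lemma cgf_mem_Icc [IsProbabilityMeasure P] (ha0 : 0 ≤ a) (hconv : ConvexOn ℝ (Dom a b) f)
    (h1 : (1 : ℝ) ∈ interior (Dom a b)) (hf1 : f 1 = 0) {h : Y → ℝ} {α β : ℝ} (hm : Measurable h)
    (hb : ∀ y, h y ∈ Icc α β) : cgf f a b P h ∈ Icc (α : EReal) (β : EReal) := by
  have hi : Integrable h P := integrable_of_forall_mem_Icc hm hb
  refine ⟨le_trans ?_ (integral_le_cgf (interior_subset h1) hf1 hi), ?_⟩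
  · exact_mod_cast (integral_mem_Icc (P := P) hm hb).1
  · have h := cgf_le_add (h' := fun _ => β) (c := 0) ha0 (interior_subset h1) hf1 hm hi
      fun y => by simpa using (hb y).2
    rw [EReal.coe_zero, add_zero] at h
    exact h.trans (cgf_const_le hconv h1 hf1 β)

lemma coe_cgfR [IsProbabilityMeasure P] (ha0 : 0 ≤ a) (hconv : ConvexOn ℝ (Dom a b) f)
    (h1 : (1 : ℝ) ∈ interior (Dom a b)) (hf1 : f 1 = 0) {h : Y → ℝ} {α β : ℝ} (hm : Measurable h)
    (hb : ∀ y, h y ∈ Icc α β) : (cgfR f a b P h : EReal) = cgf f a b P h := by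
  have hmem := cgf_mem_Icc (P := P) ha0 hconv h1 hf1 hm hb
  exact EReal.coe_toReal (ne_top_of_le_ne_top (EReal.coe_ne_top β) hmem.2)
    (ne_bot_of_le_ne_bot (EReal.coe_ne_bot α) hmem.1)

lemma cgfR_mem_Icc [IsProbabilityMeasure P] (ha0 : 0 ≤ a) (hconv : ConvexOn ℝ (Dom a b) f)
    (h1 : (1 : ℝ) ∈ interior (Dom a b)) (hf1 : f 1 = 0) {h : Y → ℝ} {α β : ℝ} (hm : Measurable h)
    (hb : ∀ y, h y ∈ Icc α β) : cgfR f a b P h ∈ Icc α β := by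
  have hmem := cgf_mem_Icc (P := P) ha0 hconv h1 hf1 hm hb
  rw [← coe_cgfR ha0 hconv h1 hf1 hm hb] at hmem
  exact ⟨EReal.coe_le_coe_iff.1 hmem.1, EReal.coe_le_coe_iff.1 hmem.2⟩

lemma cgfR_le_add [IsProbabilityMeasure P] (ha0 : 0 ≤ a) (hconv : ConvexOn ℝ (Dom a b) f)
    (h1 : (1 : ℝ) ∈ interior (Dom a b)) (hf1 : f 1 = 0) {h h' : Y → ℝ} {α β : ℝ}
    (hm : Measurable h) (hb : ∀ y, h y ∈ Icc α β) (hm' : Measurable h')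
    (hb' : ∀ y, h' y ∈ Icc α β) {c : ℝ} (hle : ∀ y, h y ≤ h' y + c) :
    cgfR f a b P h ≤ cgfR f a b P h' + c := by
  have key := cgf_le_add ha0 (interior_subset h1) hf1 hm
    (integrable_of_forall_mem_Icc (P := P) hm hb) hle
  rw [← coe_cgfR ha0 hconv h1 hf1 hm hb, ← coe_cgfR ha0 hconv h1 hf1 hm' hb',
    ← EReal.coe_add] at key
  exact EReal.coe_le_coe_iff.1 key

end CumulantGeneratingFunction

instance isProbabilityMeasure_empMeas {X : Type*} [MeasurableSpace X] {n : ℕ} [NeZero n]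
    (xs : Fin n → X) : IsProbabilityMeasure (empMeas n xs) := by
  constructor
  simp [empMeas, ENNReal.inv_mul_cancel, NeZero.ne n]

section Divergence

lemma Dfg_le {X : Type*} [MeasurableSpace X] {f : ℝ → ℝ} {a : ℝ} {b : EReal} {Γ : Set (X → ℝ)}
    {Q P : Measure X} (hne : Γ.Nonempty) {c : ℝ}
    (hc : ∀ h ∈ Γ, ∫ x, h x ∂Q - cgfR f a b P h ≤ c) : Dfg f a b Γ Q P ≤ c := by
  obtain ⟨h, hh⟩ := hne
  refine csSup_le ⟨_, h, hh, rfl⟩ ?_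
  rintro _ ⟨h, hh, rfl⟩
  exact hc h hh

variable {X : Type*} [MeasurableSpace X] {f : ℝ → ℝ} {a : ℝ} {b : EReal} {α β : ℝ}
  {Γ Γt : Set (X → ℝ)} {Q P : Measure X} [IsProbabilityMeasure Q] [IsProbabilityMeasure P]

lemma bddAbove_Dfg (ha0 : 0 ≤ a) (hconv : ConvexOn ℝ (Dom a b) f)
    (h1 : (1 : ℝ) ∈ interior (Dom a b)) (hf1 : f 1 = 0) (hm : ∀ h ∈ Γ, Measurable h)
    (hbd : ∀ h ∈ Γ, ∀ x, h x ∈ Icc α β) :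
    BddAbove {r : ℝ | ∃ h ∈ Γ, r = ∫ x, h x ∂Q - cgfR f a b P h} := by
  refine ⟨β - α, ?_⟩
  rintro _ ⟨h, hh, rfl⟩
  exact sub_le_sub (integral_mem_Icc (hm h hh) (hbd h hh)).2
    (cgfR_mem_Icc ha0 hconv h1 hf1 (hm h hh) (hbd h hh)).1

lemma le_Dfg (ha0 : 0 ≤ a) (hconv : ConvexOn ℝ (Dom a b) f)
    (h1 : (1 : ℝ) ∈ interior (Dom a b)) (hf1 : f 1 = 0) (hm : ∀ h ∈ Γ, Measurable h)
    (hbd : ∀ h ∈ Γ, ∀ x, h x ∈ Icc α β) {h : X → ℝ} (hh : h ∈ Γ) :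
    ∫ x, h x ∂Q - cgfR f a b P h ≤ Dfg f a b Γ Q P :=
  le_csSup (bddAbove_Dfg ha0 hconv h1 hf1 hm hbd) ⟨h, hh, rfl⟩

lemma neg_le_Dfg (ha0 : 0 ≤ a) (hconv : ConvexOn ℝ (Dom a b) f)
    (h1 : (1 : ℝ) ∈ interior (Dom a b)) (hf1 : f 1 = 0) (hne : Γ.Nonempty)
    (hm : ∀ h ∈ Γ, Measurable h) (hbd : ∀ h ∈ Γ, ∀ x, h x ∈ Icc α β) :
    α - β ≤ Dfg f a b Γ Q P := by
  obtain ⟨h, hh⟩ := hne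
  refine le_trans ?_ (le_Dfg ha0 hconv h1 hf1 hm hbd hh)
  exact sub_le_sub (integral_mem_Icc (hm h hh) (hbd h hh)).1
    (cgfR_mem_Icc ha0 hconv h1 hf1 (hm h hh) (hbd h hh)).2

lemma abs_sub_le_iSup {Y : Type*} {h h' : Y → ℝ} (hb : ∀ x, h x ∈ Icc α β)
    (hb' : ∀ x, h' x ∈ Icc α β) (x : Y) : |h x - h' x| ≤ ⨆ y, |h y - h' y| := by
  refine le_ciSup (f := fun y => |h y - h' y|) ⟨β - α, ?_⟩ x
  rintro _ ⟨y, rfl⟩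
  exact abs_sub_le_iff.2 ⟨sub_le_sub (hb y).2 (hb' y).1, sub_le_sub (hb' y).2 (hb y).1⟩

lemma approxErr_nonneg {Y : Type*} (Γ Γt : Set (Y → ℝ)) : 0 ≤ approxErr Γ Γt := by
  refine Real.sSup_nonneg ?_
  rintro _ ⟨h, -, rfl⟩
  refine Real.sInf_nonneg ?_
  rintro _ ⟨ht, -, rfl⟩
  exact Real.iSup_nonneg fun x => abs_nonneg _

/-- Every element of `Γ` is uniformly approximated by `Γt` up to any error exceeding
`approxErr Γ Γt`. -/
lemma exists_iSup_lt_of_approxErr_lt {Y : Type*} {Γ Γt : Set (Y → ℝ)} (hαβ : α ≤ β)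
    (hsub : Γt ⊆ Γ) (hne : Γt.Nonempty) (hbd : ∀ h ∈ Γ, ∀ x, h x ∈ Icc α β)
    {c : ℝ} (hc : approxErr Γ Γt < c) {h : Y → ℝ} (hh : h ∈ Γ) :
    ∃ ht ∈ Γt, ⨆ x, |h x - ht x| < c := by
  have hinf : ∀ h ∈ Γ, sInf {s : ℝ | ∃ ht ∈ Γt, s = ⨆ x, |h x - ht x|} ≤ β - α := by
    intro h hh
    obtain ⟨ht, hht⟩ := hne
    have hbelow : BddBelow {s : ℝ | ∃ ht ∈ Γt, s = ⨆ x, |h x - ht x|} := by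
      refine ⟨0, ?_⟩
      rintro _ ⟨_, -, rfl⟩
      exact Real.iSup_nonneg fun x => abs_nonneg _
    refine (csInf_le hbelow ⟨ht, hht, rfl⟩).trans ?_
    refine Real.iSup_le (fun x => ?_) (sub_nonneg.2 hαβ)
    exact abs_sub_le_iff.2 ⟨sub_le_sub (hbd h hh x).2 (hbd ht (hsub hht) x).1,
      sub_le_sub (hbd ht (hsub hht) x).2 (hbd h hh x).1⟩
  have hle : sInf {s : ℝ | ∃ ht ∈ Γt, s = ⨆ x, |h x - ht x|} ≤ approxErr Γ Γt := by
    refine le_csSup ⟨β - α, ?_⟩ ⟨h, hh, rfl⟩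
    rintro _ ⟨h, hh, rfl⟩
    exact hinf h hh
  obtain ⟨ht₀, hht₀⟩ := hne
  obtain ⟨_, ⟨ht, hht, rfl⟩, hlt⟩ :=
    exists_lt_of_csInf_lt (s := {s : ℝ | ∃ ht ∈ Γt, s = ⨆ x, |h x - ht x|})
      ⟨_, ht₀, hht₀, rfl⟩ (hle.trans_lt hc)
  exact ⟨ht, hht, hlt⟩

/-- Restricting the discriminators from `Γ` to `Γt` costs at most twice the approximation error. -/
lemma Dfg_le_Dfg_add_approxErr (ha0 : 0 ≤ a) (hconv : ConvexOn ℝ (Dom a b) f)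
    (h1 : (1 : ℝ) ∈ interior (Dom a b)) (hf1 : f 1 = 0) (hαβ : α ≤ β) (hsub : Γt ⊆ Γ)
    (hne : Γt.Nonempty) (hm : ∀ h ∈ Γ, Measurable h) (hbd : ∀ h ∈ Γ, ∀ x, h x ∈ Icc α β) :
    Dfg f a b Γ Q P ≤ Dfg f a b Γt Q P + 2 * approxErr Γ Γt := by
  refine Dfg_le (hne.mono hsub) fun h hh => ?_
  refine le_of_forall_pos_le_add fun δ hδ => ?_
  obtain ⟨ht, hht, hlt⟩ := exists_iSup_lt_of_approxErr_lt hαβ hsub hne hbd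
    (show approxErr Γ Γt < approxErr Γ Γt + δ / 2 by linarith) hh
  have hdist : ∀ x, |h x - ht x| ≤ approxErr Γ Γt + δ / 2 := fun x =>
    (abs_sub_le_iSup (hbd h hh) (hbd ht (hsub hht)) x).trans hlt.le
  have hΛ := cgfR_le_add (P := P) ha0 hconv h1 hf1 (hm ht (hsub hht)) (hbd ht (hsub hht)) (hm h hh)
    (hbd h hh) (c := approxErr Γ Γt + δ / 2) fun x => by linarith [(abs_le.1 (hdist x)).1]
  have hI : ∫ x, h x ∂Q ≤ ∫ x, ht x ∂Q + (approxErr Γ Γt + δ / 2) := by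
    have hti : Integrable ht Q :=
      integrable_of_forall_mem_Icc (hm ht (hsub hht)) (hbd ht (hsub hht))
    have hmono := integral_mono (integrable_of_forall_mem_Icc (P := Q) (hm h hh) (hbd h hh))
      (hti.add (integrable_const (approxErr Γ Γt + δ / 2)))
      (fun x => by simpa using (by linarith [(abs_le.1 (hdist x)).2] :
        h x ≤ ht x + (approxErr Γ Γt + δ / 2)))
    simpa [integral_add hti (integrable_const _)] using hmono
  have hD := le_Dfg (Q := Q) (P := P) ha0 hconv h1 hf1 (fun h hh => hm h (hsub hh))
    (fun h hh => hbd h (hsub hh)) hht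
  linarith

end Divergence

open MeasureTheory in
/-- `(f,Γ)`-GAN error decomposition. -/
theorem stmt9
    {X : Type*} [TopologicalSpace X] [MeasurableSpace X] [BorelSpace X]
    (f : ℝ → ℝ) (a : ℝ) (b : EReal) (α β : ℝ)
    (ha0 : 0 ≤ a) (ha1 : a < 1) (hb1 : ((1 : ℝ) : EReal) < b)
    (hconv : ConvexOn ℝ (Dom a b) f) (hf1 : f 1 = 0)
    (hstrict : ∃ ε > 0, Set.Ioo (1 - ε) (1 + ε) ⊆ Dom a b ∧
      StrictConvexOn ℝ (Set.Ioo (1 - ε) (1 + ε)) f)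
    (hz : zz f + β - α ∈ interior {z : ℝ | fStar f a b z < ⊤})
    (hαβ : α ≤ β)
    (Γt Γ : Set (X → ℝ)) (hsub : Γt ⊆ Γ) (hΓtne : Γt.Nonempty)
    (hcont : ∀ h ∈ Γ, Continuous h) (hbd : ∀ h ∈ Γ, ∀ x, h x ∈ Set.Icc α β)
    (hΓd : PtwiseDenseCount Γ) (hΓtd : PtwiseDenseCount Γt)
    {Z : Type*} [MeasurableSpace Z] (PZ : Measure Z) [IsProbabilityMeasure PZ]
    {Θ : Type*} [MetricSpace Θ] [TopologicalSpace.SeparableSpace Θ] [Nonempty Θ]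
    [MeasurableSpace Θ] [BorelSpace Θ]
    (Φ : Θ → Z → X) (hΦm : ∀ θ, Measurable (Φ θ)) (hΦc : ∀ z, Continuous fun θ => Φ θ z)
    (Q : Measure X) [IsProbabilityMeasure Q]
    {Ω : Type*} [MeasurableSpace Ω] (ℙ : Measure Ω) [IsProbabilityMeasure ℙ]
    (n m : ℕ) (hn : 0 < n) (hm : 0 < m)
    (Xs : Fin n → Ω → X) (Zs : Fin m → Ω → Z)
    (hXm : ∀ i, Measurable (Xs i)) (hZm : ∀ j, Measurable (Zs j))
    (hlaw : Measure.map (fun ω => (fun i => Xs i ω, fun j => Zs j ω)) ℙ =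
      (Measure.pi fun _ : Fin n => Q).prod (Measure.pi fun _ : Fin m => PZ))
    (θstar : Ω → Θ) (hθm : Measurable θstar)
    (εopt : ℝ) (hεopt : 0 ≤ εopt)
    (hopt : ∀ᵐ ω ∂ℙ,
      Dfg f a b Γt (empMeas n fun i => Xs i ω)
          (Measure.map (Φ (θstar ω)) (empMeas m fun j => Zs j ω)) ≤
        (⨅ θ : Θ, Dfg f a b Γt (empMeas n fun i => Xs i ω)
          (Measure.map (Φ θ) (empMeas m fun j => Zs j ω))) + εopt) :
    ∀ᵐ ω ∂ℙ,
      Dfg f a b Γ Q (Measure.map (Φ (θstar ω)) PZ)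
          - (⨅ θ : Θ, Dfg f a b Γ Q (Measure.map (Φ θ) PZ)) ≤
        sSup {r : ℝ | ∃ h ∈ Γt, ∃ θ : Θ,
            r = cgfR f a b (empMeas m fun j => Zs j ω) (fun z => h (Φ θ z))
              - cgfR f a b PZ (fun z => h (Φ θ z))}
        + sSup {r : ℝ | ∃ h ∈ Γt, ∃ θ : Θ,
            r = cgfR f a b PZ (fun z => h (Φ θ z))
              - cgfR f a b (empMeas m fun j => Zs j ω) (fun z => h (Φ θ z))}
        + sSup {r : ℝ | ∃ h ∈ Γt,
            r = (∫ x, h x ∂Q) - ∫ x, h x ∂(empMeas n fun i => Xs i ω)}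
        + sSup {r : ℝ | ∃ h ∈ Γt,
            r = (∫ x, h x ∂(empMeas n fun i => Xs i ω)) - ∫ x, h x ∂Q}
        + (1 + rderiv (fStarR f a b) (zz f + β - α)) * approxErr Γ Γt
        + εopt := by
  have h1 : (1 : ℝ) ∈ interior (Dom a b) := by
    obtain ⟨ε, hε, hεsub, -⟩ := hstrict
    exact interior_maximal hεsub isOpen_Ioo ⟨by linarith, by linarith⟩
  have hmeas : ∀ h ∈ Γ, Measurable h := fun h hh => (hcont h hh).measurable
  have hmeast : ∀ h ∈ Γt, Measurable h := fun h hh => hmeas h (hsub hh)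
  have hbdt : ∀ h ∈ Γt, ∀ x, h x ∈ Icc α β := fun h hh => hbd h (hsub hh)
  have : NeZero n := ⟨hn.ne'⟩
  have : NeZero m := ⟨hm.ne'⟩
  have hprob : ∀ (P : Measure Z) [IsProbabilityMeasure P] (θ : Θ),
      IsProbabilityMeasure (P.map (Φ θ)) := fun P _ θ =>
    Measure.isProbabilityMeasure_map (hΦm θ).aemeasurable
  have hone : 1 ≤ rderiv (fStarR f a b) (zz f + β - α) :=
    one_le_rderiv_fStarR ha0 hconv h1 hf1 (by linarith) hz
  filter_upwards [hopt] with ω hω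
  set Qn := empMeas n fun i => Xs i ω
  set Pm := empMeas m fun j => Zs j ω
  have : IsProbabilityMeasure Qn := isProbabilityMeasure_empMeas _
  have : IsProbabilityMeasure Pm := isProbabilityMeasure_empMeas _
  have hmap : ∀ (P : Measure Z) (θ : Θ), ∀ h ∈ Γt,
      cgfR f a b (P.map (Φ θ)) h = cgfR f a b P (fun z => h (Φ θ z)) := fun P θ h hh => by
    rw [cgfR, cgf_map ha0 (hΦm θ) (hmeast h hh), cgfR]
  have hcgf : ∀ (P P' : Measure Z) [IsProbabilityMeasure P] [IsProbabilityMeasure P'],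
      ∀ h ∈ Γt, ∀ θ : Θ, cgfR f a b P (fun z => h (Φ θ z)) - cgfR f a b P' (fun z => h (Φ θ z)) ≤
        sSup {r : ℝ | ∃ h ∈ Γt, ∃ θ : Θ,
          r = cgfR f a b P (fun z => h (Φ θ z)) - cgfR f a b P' (fun z => h (Φ θ z))} := by
    intro P P' _ _ h hh θ
    refine le_csSup ⟨β - α, ?_⟩ ⟨h, hh, θ, rfl⟩
    rintro _ ⟨h, hh, θ, rfl⟩
    have hmθ := (hmeast h hh).comp (hΦm θ)
    exact sub_le_sub (cgfR_mem_Icc ha0 hconv h1 hf1 hmθ fun z => hbdt h hh _).2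
      (cgfR_mem_Icc ha0 hconv h1 hf1 hmθ fun z => hbdt h hh _).1
  have hint : ∀ (σ τ : Measure X) [IsProbabilityMeasure σ] [IsProbabilityMeasure τ],
      ∀ h ∈ Γt, ∫ x, h x ∂σ - ∫ x, h x ∂τ ≤
        sSup {r : ℝ | ∃ h ∈ Γt, r = (∫ x, h x ∂σ) - ∫ x, h x ∂τ} := by
    intro σ τ _ _ h hh
    refine le_csSup ⟨β - α, ?_⟩ ⟨h, hh, rfl⟩
    rintro _ ⟨h, hh, rfl⟩
    exact sub_le_sub (integral_mem_Icc (hmeast h hh) (hbdt h hh)).2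
      (integral_mem_Icc (hmeast h hh) (hbdt h hh)).1
  have hcompare : ∀ (σ τ : Measure X) [IsProbabilityMeasure σ] [IsProbabilityMeasure τ]
      (P P' : Measure Z) [IsProbabilityMeasure P] [IsProbabilityMeasure P'] (θ : Θ),
      Dfg f a b Γt σ (P.map (Φ θ)) ≤ Dfg f a b Γt τ (P'.map (Φ θ)) +
        sSup {r : ℝ | ∃ h ∈ Γt, r = (∫ x, h x ∂σ) - ∫ x, h x ∂τ} +
        sSup {r : ℝ | ∃ h ∈ Γt, ∃ θ : Θ,
          r = cgfR f a b P' (fun z => h (Φ θ z)) - cgfR f a b P (fun z => h (Φ θ z))} := by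
    intro σ τ _ _ P P' _ _ θ
    have := hprob P' θ
    refine Dfg_le hΓtne fun h hh => ?_
    have hD := le_Dfg (Q := τ) (P := P'.map (Φ θ)) ha0 hconv h1 hf1 hmeast hbdt hh
    rw [hmap P' θ h hh] at hD
    rw [hmap P θ h hh]
    linarith [hint σ τ h hh, hcgf P' P h hh θ]
  have hupper := hcompare Q Qn PZ Pm (θstar ω)
  have hlower : (⨅ θ : Θ, Dfg f a b Γt Qn (Pm.map (Φ θ)))
      - sSup {r : ℝ | ∃ h ∈ Γt, r = (∫ x, h x ∂Qn) - ∫ x, h x ∂Q}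
      - sSup {r : ℝ | ∃ h ∈ Γt, ∃ θ : Θ,
          r = cgfR f a b PZ (fun z => h (Φ θ z)) - cgfR f a b Pm (fun z => h (Φ θ z))}
      ≤ ⨅ θ : Θ, Dfg f a b Γ Q (PZ.map (Φ θ)) := by
    refine le_ciInf fun θ => ?_
    have := hprob PZ θ
    have hinf : (⨅ θ : Θ, Dfg f a b Γt Qn (Pm.map (Φ θ))) ≤ Dfg f a b Γt Qn (Pm.map (Φ θ)) := by
      refine ciInf_le ⟨α - β, ?_⟩ θ
      rintro _ ⟨θ, rfl⟩
      have := hprob Pm θ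
      exact neg_le_Dfg ha0 hconv h1 hf1 hΓtne hmeast hbdt
    have hΓle : Dfg f a b Γt Q (PZ.map (Φ θ)) ≤ Dfg f a b Γ Q (PZ.map (Φ θ)) :=
      Dfg_le hΓtne fun h hh => le_Dfg ha0 hconv h1 hf1 hmeas hbd (hsub hh)
    linarith [hcompare Qn Q Pm PZ θ]
  have := hprob PZ (θstar ω)
  have happrox := Dfg_le_Dfg_add_approxErr (Q := Q) (P := PZ.map (Φ (θstar ω))) ha0 hconv h1 hf1
    hαβ hsub hΓtne hmeas hbd
  have hfac : 2 * approxErr Γ Γt ≤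
      (1 + rderiv (fStarR f a b) (zz f + β - α)) * approxErr Γ Γt :=
    mul_le_mul_of_nonneg_right (by linarith) (approxErr_nonneg Γ Γt)
  linarith
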